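/- For positive definite density matrices ρ, σ and any f ∈ F_op with Morozova–Chentsov function c, the divergence χ²_f(ρ,σ) = Tr((ρ−σ) c(L_σ,R_σ)(ρ−σ)) is jointly convex in (ρ,σ): χ²_f(λρ₁+(1−λ)ρ₂, λσ₁+(1−λ)σ₂) ≤ λ χ²_f(ρ₁,σ₁) + (1−λ) χ²_f(ρ₂,σ₂) for all λ ∈ [0,1]. -/

import Mathlib

open Matrix ComplexOrder

/-- Functional calculus of `f : ℝ → ℝ` on a Hermitian matrix via the spectral
theorem. -/
noncomputable def herFun {n : ℕ} (f : ℝ → ℝ) {A : Matrix (Fin n) (Fin n) ℂ}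
    (hA : A.IsHermitian) : Matrix (Fin n) (Fin n) ℂ :=
  (hA.eigenvectorUnitary : Matrix (Fin n) (Fin n) ℂ) *
    Matrix.diagonal (Complex.ofReal ∘ f ∘ hA.eigenvalues) *
    star (hA.eigenvectorUnitary : Matrix (Fin n) (Fin n) ℂ)

/-- `f` is operator monotone on `(0,∞)`. -/
def OperatorMonotone (f : ℝ → ℝ) : Prop :=
  ∀ (n : ℕ) (A B : Matrix (Fin n) (Fin n) ℂ) (hA : A.PosDef) (hB : B.PosDef),
    (B - A).PosSemidef → (herFun f hB.1 - herFun f hA.1).PosSemidef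

/-- The divergence `χ²_f(ρ,σ) = Tr((ρ−σ) c(L_σ,R_σ)(ρ−σ))` expressed in the
eigenbasis of `σ`: it equals `Σ_{i,j} c(μ_i,μ_j) |⟨e_i,(ρ−σ)e_j⟩|²`, where
`c(x,y) = 1/(y f(x/y))` is the Morozova–Chentsov function, `μ_i` are the
eigenvalues of `σ` and `e_i` an orthonormal eigenbasis. -/
noncomputable def chiSq (f : ℝ → ℝ) {n : ℕ} (ρ σ : Matrix (Fin n) (Fin n) ℂ)
    (hσ : σ.IsHermitian) : ℝ :=
  ∑ i, ∑ j, (1 / (hσ.eigenvalues j * f (hσ.eigenvalues i / hσ.eigenvalues j))) *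
    ‖star (fun k => hσ.eigenvectorBasis i k) ⬝ᵥ
      ((ρ - σ) *ᵥ fun k => hσ.eigenvectorBasis j k)‖ ^ 2

section HerFun

variable {N : ℕ} {κ : Type*} [Fintype κ] [DecidableEq κ]

lemma herFun_mul_of_mul_diagonal (f : ℝ → ℝ) {B : Matrix (Fin N) (Fin N) ℂ} (hB : B.IsHermitian)
    (V : Matrix (Fin N) κ ℂ) (e : κ → ℝ)
    (h : B * V = V * diagonal (Complex.ofReal ∘ e)) :
    herFun f hB * V = V * diagonal (Complex.ofReal ∘ f ∘ e) := by
  set U : Matrix (Fin N) (Fin N) ℂ :=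
    (hB.eigenvectorUnitary : Matrix (Fin N) (Fin N) ℂ) with hU
  have hUU : star U * U = 1 := Unitary.coe_star_mul_self hB.eigenvectorUnitary
  have hUU' : U * star U = 1 := Unitary.coe_mul_star_self hB.eigenvectorUnitary
  have hsp : B = U * diagonal (Complex.ofReal ∘ hB.eigenvalues) * star U := hB.spectral_theorem
  have hM : diagonal (Complex.ofReal ∘ hB.eigenvalues) * (star U * V) =
      (star U * V) * diagonal (Complex.ofReal ∘ e) := by
    rw [Matrix.mul_assoc (star U), ← h]
    conv_rhs => rw [hsp]
    simp only [← Matrix.mul_assoc, hUU, Matrix.one_mul]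
  have hM' : diagonal (Complex.ofReal ∘ f ∘ hB.eigenvalues) * (star U * V) =
      (star U * V) * diagonal (Complex.ofReal ∘ f ∘ e) := by
    ext i j
    have hij := congrFun (congrFun hM i) j
    rw [diagonal_mul, mul_diagonal] at hij ⊢
    by_cases h0 : (star U * V) i j = 0
    · simp [h0]
    · rw [mul_comm] at hij
      have := mul_left_cancel₀ h0 hij
      have h' : hB.eigenvalues i = e j := by simpa using this
      simp [h', mul_comm]
  calc herFun f hB * V = U * (diagonal (Complex.ofReal ∘ f ∘ hB.eigenvalues) * (star U * V)) := by
        simp only [herFun, ← hU, Matrix.mul_assoc]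
    _ = V * diagonal (Complex.ofReal ∘ f ∘ e) := by
        rw [hM', ← Matrix.mul_assoc, ← Matrix.mul_assoc, hUU', Matrix.one_mul]

lemma herFun_diagonal (f : ℝ → ℝ) (d : Fin N → ℝ)
    (h : (diagonal (Complex.ofReal ∘ d)).IsHermitian) :
    herFun f h = diagonal (Complex.ofReal ∘ f ∘ d) := by
  simpa using herFun_mul_of_mul_diagonal f h 1 d (by simp)

lemma posDef_diagonal_ofReal {d : Fin N → ℝ} (hd : ∀ a, 0 < d a) :
    (diagonal (Complex.ofReal ∘ d)).PosDef :=
  PosDef.diagonal fun a => by simpa using hd a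

lemma OperatorMonotone.monotoneOn {f : ℝ → ℝ} (hf : OperatorMonotone f) {x y : ℝ} (hx : 0 < x)
    (hxy : x ≤ y) : f x ≤ f y := by
  have h := hf 1 _ _ (posDef_diagonal_ofReal (d := fun _ => x) fun _ => hx)
    (posDef_diagonal_ofReal (d := fun _ => y) fun _ => hx.trans_le hxy) (by
      rw [diagonal_sub, posSemidef_diagonal_iff]
      intro i
      simpa [← Complex.ofReal_sub] using hxy)
  rw [herFun_diagonal, herFun_diagonal, diagonal_sub, posSemidef_diagonal_iff] at h
  simpa [← Complex.ofReal_sub] using h 0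

lemma OperatorMonotone.map_mul_le {f : ℝ → ℝ} (hf : OperatorMonotone f)
    (hsym : ∀ t : ℝ, 0 < t → f t = t * f t⁻¹) {s x : ℝ} (hs : 1 ≤ s) (hx : 0 < x) :
    f (s * x) ≤ s * f x := by
  have hs0 : 0 < s := by linarith
  have hsx : 0 < s * x := by positivity
  rw [hsym _ hsx, hsym x hx, ← mul_assoc]
  gcongr
  refine hf.monotoneOn (by positivity) ?_
  gcongr
  nlinarith

lemma star_dotProduct_diagonal_mulVec {ι : Type*} [Fintype ι] [DecidableEq ι] (d : ι → ℝ)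
    (v : ι → ℂ) :
    star v ⬝ᵥ (diagonal (Complex.ofReal ∘ d) *ᵥ v) = ((∑ a, d a * ‖v a‖ ^ 2 : ℝ) : ℂ) := by
  simp only [dotProduct, mulVec_diagonal, Pi.star_apply, Function.comp]
  push_cast
  refine Finset.sum_congr rfl fun a _ => ?_
  rw [← Complex.conj_mul']
  simp only [RCLike.star_def]
  ring

/-- A positive operator is dominated by a dilated version of its compression to `P`, plus a large
multiple of the complementary projection. -/
lemma posSemidef_pinching_sub {A P : Matrix (Fin N) (Fin N) ℂ} (hA : A.PosSemidef)
    (hP : P.IsHermitian) {M t : ℝ} (ht : t ≠ 0)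
    (hM : ((M : ℂ) • 1 - A).PosSemidef) (hPP : P * P = P) :
    (((1 + t ^ 2 : ℝ) : ℂ) • (P * A * P) + (((1 + (t ^ 2)⁻¹) * M : ℝ) : ℂ) • (1 - P) -
      A).PosSemidef := by
  have h1 := hA.mul_mul_conjTranspose_same ((t : ℂ) • P - (t : ℂ)⁻¹ • (1 - P))
  have h2 := (hM.mul_mul_conjTranspose_same (1 - P)).smul
    (show (0 : ℂ) ≤ ((1 + (t ^ 2)⁻¹ : ℝ) : ℂ) by
      rw [Complex.zero_le_real]; positivity)
  have h3 := h1.add h2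
  have htc : (t : ℂ) ≠ 0 := by exact_mod_cast ht
  convert h3 using 1
  have e1 : ((t : ℂ) • P - (t : ℂ)⁻¹ • (1 - P))ᴴ = (t : ℂ) • P - (t : ℂ)⁻¹ • (1 - P) := by
    simp [conjTranspose_sub, conjTranspose_smul, hP.eq]
  have e2 : (1 - P)ᴴ = 1 - P := by simp [conjTranspose_sub, hP.eq]
  have e3 : (1 - P) * ((M : ℂ) • 1 - A) * (1 - P) =
      (M : ℂ) • (1 - P) - (A - P * A - A * P + P * A * P) := by
    have : (1 - P) * (1 - P) = 1 - P := by
      simp [Matrix.mul_sub, Matrix.sub_mul, hPP]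
    rw [Matrix.mul_sub (1 - P), Matrix.sub_mul ((1 - P) * _), Matrix.mul_smul, Matrix.smul_mul, Matrix.mul_one, this]
    noncomm_ring
  have e4 : ((t : ℂ) • P - (t : ℂ)⁻¹ • (1 - P)) * A * ((t : ℂ) • P - (t : ℂ)⁻¹ • (1 - P)) =
      ((t : ℂ) ^ 2) • (P * A * P) - (P * A - P * A * P) - (A * P - P * A * P) +
        ((t : ℂ) ^ 2)⁻¹ • (A - P * A - A * P + P * A * P) := by
    have i1 : (t : ℂ) * (t : ℂ)⁻¹ = 1 := mul_inv_cancel₀ htc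
    have i2 : (t : ℂ)⁻¹ * (t : ℂ) = 1 := inv_mul_cancel₀ htc
    simp only [Matrix.sub_mul, Matrix.mul_sub, Matrix.smul_mul, Matrix.mul_smul, smul_sub, smul_smul,
      i1, i2, Matrix.one_mul, Matrix.mul_one, one_smul]
    simp only [← sq, inv_pow, smul_add, smul_sub]
    abel
  rw [e1, e2, e3, e4]
  push_cast
  module

/-- Jensen's operator inequality for an isometry compressing a diagonal operator to a diagonal
one. -/
lemma OperatorMonotone.sum_isometry_le_fin {f : ℝ → ℝ} (hf : OperatorMonotone f)
    (hsym : ∀ t : ℝ, 0 < t → f t = t * f t⁻¹) {d : Fin N → ℝ} (hd : ∀ a, 0 < d a)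
    {e : κ → ℝ} (he : ∀ b, 0 < e b) (V : Matrix (Fin N) κ ℂ) (hV : Vᴴ * V = 1)
    (hVd : Vᴴ * diagonal (Complex.ofReal ∘ d) * V = diagonal (Complex.ofReal ∘ e)) (y : κ → ℂ) :
    ∑ a, f (d a) * ‖(V *ᵥ y) a‖ ^ 2 ≤ ∑ b, f (e b) * ‖y b‖ ^ 2 := by
  have key : ∀ t : ℝ, t ≠ 0 → ∑ a, f (d a) * ‖(V *ᵥ y) a‖ ^ 2 ≤
      (1 + t ^ 2) * ∑ b, f (e b) * ‖y b‖ ^ 2 := by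
    intro t ht
    set A : Matrix (Fin N) (Fin N) ℂ := diagonal (Complex.ofReal ∘ d) with hAdef
    have hA : A.PosDef := posDef_diagonal_ofReal hd
    set P := V * Vᴴ with hPdef
    have hP : P.IsHermitian := isHermitian_mul_conjTranspose_self V
    have hPV : P * V = V := by rw [hPdef, Matrix.mul_assoc, hV, Matrix.mul_one]
    have hPP : P * P = P := by
      conv_lhs => rw [hPdef, ← Matrix.mul_assoc, ← hPdef, hPV]
    set M := ∑ a, d a
    have hM : ((M : ℂ) • 1 - A).PosSemidef := by
      rw [smul_one_eq_diagonal, hAdef, diagonal_sub, posSemidef_diagonal_iff]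
      intro a
      have : d a ≤ M := Finset.single_le_sum (fun i _ => (hd i).le) (Finset.mem_univ a)
      simpa [← Complex.ofReal_sub] using this
    set B := ((1 + t ^ 2 : ℝ) : ℂ) • (P * A * P) + (((1 + (t ^ 2)⁻¹) * M : ℝ) : ℂ) • (1 - P)
      with hBdef
    have hBA : (B - A).PosSemidef := posSemidef_pinching_sub hA.posSemidef hP ht hM hPP
    have hB : B.PosDef := by simpa using hA.add_posSemidef hBA
    have hBV : B * V = V * diagonal (Complex.ofReal ∘ fun b => (1 + t ^ 2) * e b) := by
      have h1 : P * A * P * V = V * diagonal (Complex.ofReal ∘ e) := by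
        rw [Matrix.mul_assoc, hPV, ← hVd, hPdef]
        simp only [Matrix.mul_assoc]
      have h2 : diagonal (Complex.ofReal ∘ fun b => (1 + t ^ 2) * e b) =
          ((1 + t ^ 2 : ℝ) : ℂ) • diagonal (Complex.ofReal ∘ e) := by
        rw [← diagonal_smul]
        congr 1
        ext b
        simp
      rw [hBdef, Matrix.add_mul, Matrix.smul_mul, Matrix.smul_mul, h1, Matrix.sub_mul, hPV,
        Matrix.one_mul, sub_self, smul_zero, add_zero, h2, Matrix.mul_smul]
    have hfle := (hf N A B hA hB hBA).dotProduct_mulVec_nonneg (V *ᵥ y)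
    have hVfB : star (V *ᵥ y) ⬝ᵥ (herFun f hB.1 *ᵥ (V *ᵥ y)) =
        star y ⬝ᵥ (diagonal (Complex.ofReal ∘ f ∘ fun b => (1 + t ^ 2) * e b) *ᵥ y) := by
      rw [mulVec_mulVec, herFun_mul_of_mul_diagonal f hB.1 V _ hBV, star_mulVec,
        ← mulVec_mulVec, dotProduct_mulVec, vecMul_vecMul, hV, vecMul_one]
    rw [sub_mulVec, dotProduct_sub, hVfB, herFun_diagonal, star_dotProduct_diagonal_mulVec,
      star_dotProduct_diagonal_mulVec, ← Complex.ofReal_sub, Complex.zero_le_real,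
      sub_nonneg] at hfle
    refine hfle.trans ?_
    rw [Finset.mul_sum]
    refine Finset.sum_le_sum fun b _ => ?_
    rw [← mul_assoc]
    gcongr
    exact hf.map_mul_le hsym (by nlinarith [sq_nonneg t]) (he b)
  set S := ∑ b, f (e b) * ‖y b‖ ^ 2
  have hlim : Filter.Tendsto (fun t : ℝ => (1 + t ^ 2) * S) (nhdsWithin 0 {0}ᶜ) (nhds S) := by
    have : Continuous fun t : ℝ => (1 + t ^ 2) * S := by fun_prop
    simpa using (this.tendsto 0).mono_left nhdsWithin_le_nhds
  exact ge_of_tendsto hlim (eventually_nhdsWithin_of_forall fun t ht => key t ht)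

lemma OperatorMonotone.sum_isometry_le {ι : Type*} [Fintype ι] [DecidableEq ι] {f : ℝ → ℝ}
    (hf : OperatorMonotone f) (hsym : ∀ t : ℝ, 0 < t → f t = t * f t⁻¹) {d : ι → ℝ}
    (hd : ∀ a, 0 < d a) {e : κ → ℝ} (he : ∀ b, 0 < e b) (V : Matrix ι κ ℂ) (hV : Vᴴ * V = 1)
    (hVd : Vᴴ * diagonal (Complex.ofReal ∘ d) * V = diagonal (Complex.ofReal ∘ e)) (y : κ → ℂ) :
    ∑ a, f (d a) * ‖(V *ᵥ y) a‖ ^ 2 ≤ ∑ b, f (e b) * ‖y b‖ ^ 2 := by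
  let E := (Fintype.equivFin ι).symm
  have h := hf.sum_isometry_le_fin hsym (d := d ∘ E) (fun a => hd _) he (V.submatrix E id)
    (by
      rw [conjTranspose_submatrix, submatrix_mul_equiv, hV]
      simp)
    (by
      have : diagonal (Complex.ofReal ∘ d ∘ E) =
          (diagonal (Complex.ofReal ∘ d)).submatrix E E := by
        rw [submatrix_diagonal_equiv]; rfl
      rw [conjTranspose_submatrix, this, submatrix_mul_equiv, submatrix_mul_equiv, hVd]
      simp) y
  rw [← E.sum_comp]
  exact h

end HerFun

section Perspective

variable {n : ℕ} {K : Type*}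

lemma diagonal_ofReal_one {ι : Type*} [DecidableEq ι] :
    diagonal (Complex.ofReal ∘ fun _ : ι => (1 : ℝ)) = 1 := by
  rw [← diagonal_one]
  congr 1

lemma Complex.ofReal_sqrt_mul_self {x : ℝ} (hx : 0 ≤ x) : (√x : ℂ) * (√x : ℂ) = x := by
  rw [← Complex.ofReal_mul, Real.mul_self_sqrt hx]

lemma Complex.ofReal_sqrt_ne_zero {x : ℝ} (hx : 0 < x) : (√x : ℂ) ≠ 0 := by
  exact_mod_cast (Real.sqrt_pos.2 hx).ne'

/-- The operator `X ↦ (√w_k X σ^{-1/2} σ_k^{1/2})_k`, written in the eigenbases of `σ` (eigenvalues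
`e`) and of the `σ_k` (eigenvalues `d k`), with `W k` the change of basis. -/
noncomputable def perspectiveIsometry (w : K → ℝ) (d : K → Fin n → ℝ) (e : Fin n → ℝ)
    (W : K → Matrix (Fin n) (Fin n) ℂ) : Matrix (K × Fin n × Fin n) (Fin n × Fin n) ℂ :=
  .of fun a b =>
    √(w a.1) * W a.1 a.2.1 b.1 * star (W a.1 a.2.2 b.2) * √(d a.1 a.2.2) * (√(e b.2) : ℂ)⁻¹

variable {w : K → ℝ} {d : K → Fin n → ℝ} {e : Fin n → ℝ}

lemma perspectiveIsometry_mulVec (he : ∀ i, 0 < e i)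
    (W : K → Matrix (Fin n) (Fin n) ℂ)
    (Y : Matrix (Fin n) (Fin n) ℂ) (k : K) (i j : Fin n) :
    (perspectiveIsometry w d e W *ᵥ fun b => √(e b.2) * Y b.1 b.2) (k, i, j) =
      √(w k) * √(d k j) * (W k * Y * (W k)ᴴ) i j := by
  simp only [mulVec, dotProduct, Fintype.sum_prod_type, perspectiveIsometry, of_apply,
    Matrix.mul_apply, conjTranspose_apply, Finset.sum_mul, Finset.mul_sum]
  rw [Finset.sum_comm]
  refine Finset.sum_congr rfl fun b _ => Finset.sum_congr rfl fun a _ => ?_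
  have := Complex.ofReal_sqrt_ne_zero (he b)
  field_simp

variable [Fintype K] [DecidableEq K]

lemma perspectiveIsometry_compress_apply (hw : ∀ k, 0 ≤ w k)
    (hd : ∀ k i, 0 < d k i) (W : K → Matrix (Fin n) (Fin n) ℂ)
    (g h : K → Fin n → ℝ) (i j i' j' : Fin n) :
    ((perspectiveIsometry w d e W)ᴴ *
        diagonal (Complex.ofReal ∘ fun a : K × Fin n × Fin n => g a.1 a.2.1 * h a.1 a.2.2) *
        perspectiveIsometry w d e W) (i, j) (i', j') =
      (√(e j) : ℂ)⁻¹ * (√(e j') : ℂ)⁻¹ * ∑ k, (w k : ℂ) *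
        (((W k)ᴴ * diagonal (Complex.ofReal ∘ g k) * W k) i i' *
          ((W k)ᴴ * diagonal (Complex.ofReal ∘ fun b => d k b * h k b) * W k) j' j) := by
  rw [Matrix.mul_apply]
  simp only [Matrix.mul_apply (M := (W _)ᴴ * _), mul_diagonal, conjTranspose_apply,
    Fintype.sum_prod_type, perspectiveIsometry, of_apply, Finset.sum_mul_sum]
  simp only [Finset.mul_sum]
  refine Finset.sum_congr rfl fun k _ => Finset.sum_congr rfl fun a _ =>
    Finset.sum_congr rfl fun b _ => ?_
  simp only [star_mul', RCLike.star_def, map_inv₀, Complex.conj_ofReal, Complex.conj_conj,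
    Function.comp, Complex.ofReal_mul]
  rw [← Complex.ofReal_sqrt_mul_self (hw k), ← Complex.ofReal_sqrt_mul_self (hd k b).le]
  ring

lemma perspectiveIsometry_conjTranspose_mul_self (hw : ∀ k, 0 ≤ w k)
    (hd : ∀ k i, 0 < d k i) (he : ∀ i, 0 < e i)
    (W : K → Matrix (Fin n) (Fin n) ℂ) (hW : ∀ k, (W k)ᴴ * W k = 1)
    (hWd : ∑ k, (w k : ℂ) • ((W k)ᴴ * diagonal (Complex.ofReal ∘ d k) * W k) =
      diagonal (Complex.ofReal ∘ e)) :
    (perspectiveIsometry w d e W)ᴴ * perspectiveIsometry w d e W = 1 := by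
  ext ⟨i, j⟩ ⟨i', j'⟩
  have h := perspectiveIsometry_compress_apply hw hd (e := e) W (fun _ _ => 1) (fun _ _ => 1)
    i j i' j'
  have hWd' := congrFun (congrFun hWd j') j
  simp only [Matrix.sum_apply, Matrix.smul_apply, smul_eq_mul] at hWd'
  simp only [mul_one, diagonal_ofReal_one, Matrix.mul_one, hW, mul_left_comm (w _ : ℂ)] at h
  rw [h, ← Finset.mul_sum]
  rw [hWd']
  simp only [Matrix.one_apply, diagonal_apply, Prod.mk.injEq]
  by_cases hj : j = j'
  · subst hj
    have := Complex.ofReal_sqrt_ne_zero (he j)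
    simp only [if_true, Function.comp, and_true]
    rw [← Complex.ofReal_sqrt_mul_self (he j).le]
    field_simp
  · simp [hj, Ne.symm hj]

lemma perspectiveIsometry_compress_diagonal (hw : ∀ k, 0 ≤ w k)
    (hd : ∀ k i, 0 < d k i) (he : ∀ i, 0 < e i)
    (W : K → Matrix (Fin n) (Fin n) ℂ) (hW : ∀ k, (W k)ᴴ * W k = 1)
    (hWd : ∑ k, (w k : ℂ) • ((W k)ᴴ * diagonal (Complex.ofReal ∘ d k) * W k) =
      diagonal (Complex.ofReal ∘ e)) :
    (perspectiveIsometry w d e W)ᴴ *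
        diagonal (Complex.ofReal ∘ fun a : K × Fin n × Fin n => d a.1 a.2.1 / d a.1 a.2.2) *
        perspectiveIsometry w d e W =
      diagonal (Complex.ofReal ∘ fun b : Fin n × Fin n => e b.1 / e b.2) := by
  ext ⟨i, j⟩ ⟨i', j'⟩
  have h := perspectiveIsometry_compress_apply hw hd (e := e) W d (fun k b => (d k b)⁻¹)
    i j i' j'
  have hWd' := congrFun (congrFun hWd i) i'
  simp only [Matrix.sum_apply, Matrix.smul_apply, smul_eq_mul] at hWd'
  simp only [mul_inv_cancel₀ (hd _ _).ne', diagonal_ofReal_one, Matrix.mul_one, hW, ← mul_assoc (w _ : ℂ)] at h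
  simp only [div_eq_mul_inv]
  rw [h, ← Finset.sum_mul, hWd']
  simp only [Matrix.one_apply, diagonal_apply, Prod.mk.injEq]
  by_cases hj : j = j'
  · subst hj
    have := Complex.ofReal_sqrt_ne_zero (he j)
    by_cases hi : i = i'
    · simp only [hi, if_true, and_self, mul_one, Function.comp, Complex.ofReal_mul,
        Complex.ofReal_inv]
      rw [← Complex.ofReal_sqrt_mul_self (he j).le]
      field_simp
    · simp [hi]
  · simp [hj, Ne.symm hj]

/-- Concavity of the operator perspective `y f(x/y)` of left and right multiplications, in
eigenbasis coordinates. -/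
lemma OperatorMonotone.sum_perspective_le {f : ℝ → ℝ} (hf : OperatorMonotone f)
    (hsym : ∀ t : ℝ, 0 < t → f t = t * f t⁻¹) (hw : ∀ k, 0 ≤ w k)
    (hd : ∀ k i, 0 < d k i) (he : ∀ i, 0 < e i)
    (W : K → Matrix (Fin n) (Fin n) ℂ) (hW : ∀ k, (W k)ᴴ * W k = 1)
    (hWd : ∑ k, (w k : ℂ) • ((W k)ᴴ * diagonal (Complex.ofReal ∘ d k) * W k) =
      diagonal (Complex.ofReal ∘ e))
    (Y : Matrix (Fin n) (Fin n) ℂ) :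
    ∑ k, w k * ∑ i, ∑ j, d k j * f (d k i / d k j) * ‖(W k * Y * (W k)ᴴ) i j‖ ^ 2 ≤
      ∑ i, ∑ j, e j * f (e i / e j) * ‖Y i j‖ ^ 2 := by
  have h := hf.sum_isometry_le hsym
    (d := fun a : K × Fin n × Fin n => d a.1 a.2.1 / d a.1 a.2.2)
    (fun a => div_pos (hd a.1 a.2.1) (hd a.1 a.2.2))
    (e := fun b : Fin n × Fin n => e b.1 / e b.2)
    (fun b => div_pos (he b.1) (he b.2)) (perspectiveIsometry w d e W)
    (perspectiveIsometry_conjTranspose_mul_self hw hd he W hW hWd)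
    (perspectiveIsometry_compress_diagonal hw hd he W hW hWd)
    (fun b => √(e b.2) * Y b.1 b.2)
  simp only [Fintype.sum_prod_type, perspectiveIsometry_mulVec he, norm_mul, Complex.norm_real,
    Real.norm_eq_abs, abs_of_nonneg (Real.sqrt_nonneg _), mul_pow, Real.sq_sqrt (hw _),
    Real.sq_sqrt (hd _ _).le, Real.sq_sqrt (he _).le] at h
  convert h using 1
  · simp only [Finset.mul_sum]
    refine Finset.sum_congr rfl fun k _ => Finset.sum_congr rfl fun i _ =>
      Finset.sum_congr rfl fun j _ => ?_
    ring
  · refine Finset.sum_congr rfl fun i _ => Finset.sum_congr rfl fun j _ => ?_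
    ring

end Perspective

section ChiSq

variable {n : ℕ}

lemma Matrix.IsHermitian.star_eigenvectorBasis_dotProduct_mulVec
    {σ : Matrix (Fin n) (Fin n) ℂ} (hσ : σ.IsHermitian) (X : Matrix (Fin n) (Fin n) ℂ)
    (i j : Fin n) :
    star (fun k => hσ.eigenvectorBasis i k) ⬝ᵥ (X *ᵥ fun k => hσ.eigenvectorBasis j k) =
      ((hσ.eigenvectorUnitary : Matrix (Fin n) (Fin n) ℂ)ᴴ * X *
        (hσ.eigenvectorUnitary : Matrix (Fin n) (Fin n) ℂ)) i j := by
  rw [Matrix.mul_assoc]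
  simp [Matrix.mul_apply, dotProduct, mulVec, IsHermitian.eigenvectorUnitary_apply]

lemma trace_conjTranspose_mul_eq_sum (X Z : Matrix (Fin n) (Fin n) ℂ) :
    (Xᴴ * Z).trace = ∑ i, ∑ j, star (X i j) * Z i j := by
  simp only [trace, diag, Matrix.mul_apply, conjTranspose_apply]
  exact Finset.sum_comm

lemma trace_conjTranspose_mul_conj {U : Matrix (Fin n) (Fin n) ℂ} (hU : U * Uᴴ = 1)
    (X Z : Matrix (Fin n) (Fin n) ℂ) :
    ((Uᴴ * X * U)ᴴ * (Uᴴ * Z * U)).trace = (Xᴴ * Z).trace := by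
  have : (Uᴴ * X * U)ᴴ * (Uᴴ * Z * U) = Uᴴ * (Xᴴ * (U * Uᴴ) * Z * U) := by
    simp only [conjTranspose_mul, conjTranspose_conjTranspose, Matrix.mul_assoc]
  rw [this, trace_mul_comm, hU, Matrix.mul_one, Matrix.mul_assoc, hU, Matrix.mul_one]

lemma two_mul_re_star_mul_sub_le {F : ℝ} (hF : 0 < F) (x z : ℂ) :
    2 * (star x * z).re - F * ‖x‖ ^ 2 ≤ 1 / F * ‖z‖ ^ 2 := by
  have h : (star x * z).re ≤ ‖x‖ * ‖z‖ := by
    simpa using Complex.re_le_norm (star x * z)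
  have h2 : 0 ≤ 1 / F * (F * ‖x‖ - ‖z‖) ^ 2 := by positivity
  have h3 : 1 / F * (F * ‖x‖ - ‖z‖) ^ 2 = F * ‖x‖ ^ 2 - 2 * (‖x‖ * ‖z‖) + 1 / F * ‖z‖ ^ 2 := by
    field_simp
    ring
  linarith

/-- The quadratic form `X ↦ Tr(X* F(L_σ,R_σ) X)` with `F(x,y) = y f(x/y)`, dual to `chiSq`. -/
noncomputable def perspectiveForm (f : ℝ → ℝ) {σ : Matrix (Fin n) (Fin n) ℂ} (hσ : σ.IsHermitian)
    (X : Matrix (Fin n) (Fin n) ℂ) : ℝ :=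
  ∑ i, ∑ j, hσ.eigenvalues j * f (hσ.eigenvalues i / hσ.eigenvalues j) *
    ‖((hσ.eigenvectorUnitary : Matrix (Fin n) (Fin n) ℂ)ᴴ * X *
      (hσ.eigenvectorUnitary : Matrix (Fin n) (Fin n) ℂ)) i j‖ ^ 2

lemma two_mul_re_trace_sub_perspectiveForm_le {f : ℝ → ℝ} (hfpos : ∀ t : ℝ, 0 < t → 0 < f t)
    (ρ : Matrix (Fin n) (Fin n) ℂ) {σ : Matrix (Fin n) (Fin n) ℂ} (hσ : σ.PosDef)
    (X : Matrix (Fin n) (Fin n) ℂ) :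
    2 * (Xᴴ * (ρ - σ)).trace.re - perspectiveForm f hσ.1 X ≤ chiSq f ρ σ hσ.1 := by
  rw [← trace_conjTranspose_mul_conj (Unitary.coe_mul_star_self hσ.1.eigenvectorUnitary),
    trace_conjTranspose_mul_eq_sum]
  simp only [chiSq, perspectiveForm, hσ.1.star_eigenvectorBasis_dotProduct_mulVec,
    Complex.re_sum, Finset.mul_sum, ← Finset.sum_sub_distrib]
  refine Finset.sum_le_sum fun i _ => Finset.sum_le_sum fun j _ => ?_
  have hi := hσ.eigenvalues_pos i
  have hj := hσ.eigenvalues_pos j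
  exact two_mul_re_star_mul_sub_le (mul_pos hj (hfpos _ (div_pos hi hj))) _ _

lemma exists_chiSq_eq_two_mul_re_trace_sub {f : ℝ → ℝ} (hfpos : ∀ t : ℝ, 0 < t → 0 < f t)
    (ρ : Matrix (Fin n) (Fin n) ℂ) {σ : Matrix (Fin n) (Fin n) ℂ} (hσ : σ.PosDef) :
    ∃ X : Matrix (Fin n) (Fin n) ℂ,
      chiSq f ρ σ hσ.1 = 2 * (Xᴴ * (ρ - σ)).trace.re - perspectiveForm f hσ.1 X := by
  set U : Matrix (Fin n) (Fin n) ℂ :=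
    (hσ.1.eigenvectorUnitary : Matrix (Fin n) (Fin n) ℂ) with hU
  have hUU : Uᴴ * U = 1 := Unitary.coe_star_mul_self hσ.1.eigenvectorUnitary
  have hUU' : U * Uᴴ = 1 := Unitary.coe_mul_star_self hσ.1.eigenvectorUnitary
  let F : Fin n → Fin n → ℝ := fun i j =>
    hσ.1.eigenvalues j * f (hσ.1.eigenvalues i / hσ.1.eigenvalues j)
  let Y : Matrix (Fin n) (Fin n) ℂ := .of fun i j => (Uᴴ * (ρ - σ) * U) i j / F i j
  have hY : Uᴴ * (U * Y * Uᴴ) * U = Y := by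
    rw [Matrix.mul_assoc, Matrix.mul_assoc, hUU, Matrix.mul_one, ← Matrix.mul_assoc, hUU,
      Matrix.one_mul]
  refine ⟨U * Y * Uᴴ, ?_⟩
  rw [← trace_conjTranspose_mul_conj hUU', trace_conjTranspose_mul_eq_sum]
  simp only [chiSq, perspectiveForm, hσ.1.star_eigenvectorBasis_dotProduct_mulVec, ← hU, hY,
    Complex.re_sum, Finset.mul_sum, ← Finset.sum_sub_distrib]
  refine Finset.sum_congr rfl fun i _ => Finset.sum_congr rfl fun j _ => ?_
  have hi := hσ.eigenvalues_pos i
  have hj := hσ.eigenvalues_pos j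
  have hF : 0 < F i j := mul_pos hj (hfpos _ (div_pos hi hj))
  change 1 / F i j * _ = 2 * _ - F i j * _
  simp only [Y, of_apply]
  generalize (Uᴴ * (ρ - σ) * U) i j = z
  have h1 : (star (z / (F i j : ℂ)) * z).re = ‖z‖ ^ 2 / F i j := by
    have : star (z / (F i j : ℂ)) * z = ((‖z‖ ^ 2 / F i j : ℝ) : ℂ) := by
      push_cast
      rw [← Complex.conj_mul', RCLike.star_def, map_div₀, Complex.conj_ofReal]
      ring
    rw [this, Complex.ofReal_re]
  rw [h1, norm_div, Complex.norm_real, Real.norm_eq_abs, abs_of_pos hF]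
  field_simp
  ring

/-- Concavity of `perspectiveForm` in the base point. -/
lemma OperatorMonotone.perspectiveForm_concave {f : ℝ → ℝ} (hf : OperatorMonotone f)
    (hsym : ∀ t : ℝ, 0 < t → f t = t * f t⁻¹) {K : Type*} [Fintype K] [DecidableEq K]
    {w : K → ℝ} (hw : ∀ k, 0 ≤ w k) {s : K → Matrix (Fin n) (Fin n) ℂ} (hs : ∀ k, (s k).PosDef)
    {σ : Matrix (Fin n) (Fin n) ℂ} (hσ : σ.PosDef) (hsum : σ = ∑ k, (w k : ℂ) • s k)
    (X : Matrix (Fin n) (Fin n) ℂ) :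
    ∑ k, w k * perspectiveForm f (hs k).1 X ≤ perspectiveForm f hσ.1 X := by
  set U : Matrix (Fin n) (Fin n) ℂ :=
    (hσ.1.eigenvectorUnitary : Matrix (Fin n) (Fin n) ℂ) with hU
  have hUU : Uᴴ * U = 1 := Unitary.coe_star_mul_self hσ.1.eigenvectorUnitary
  have hUU' : U * Uᴴ = 1 := Unitary.coe_mul_star_self hσ.1.eigenvectorUnitary
  let T : K → Matrix (Fin n) (Fin n) ℂ := fun k => (hs k).1.eigenvectorUnitary
  have hTT : ∀ k, T k * (T k)ᴴ = 1 := fun k =>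
    Unitary.coe_mul_star_self (hs k).1.eigenvectorUnitary
  have hspec : σ = U * diagonal (Complex.ofReal ∘ hσ.1.eigenvalues) * Uᴴ :=
    hσ.1.spectral_theorem
  have hspec' : ∀ k, s k = T k * diagonal (Complex.ofReal ∘ (hs k).1.eigenvalues) * (T k)ᴴ :=
    fun k => (hs k).1.spectral_theorem
  have h := hf.sum_perspective_le hsym hw (fun k i => (hs k).eigenvalues_pos i)
    (fun i => hσ.eigenvalues_pos i) (fun k => (T k)ᴴ * U)
    (fun k => by
      rw [conjTranspose_mul, conjTranspose_conjTranspose, Matrix.mul_assoc,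
        ← Matrix.mul_assoc (T k), hTT, Matrix.one_mul, hUU])
    (by
      have h1 : ∀ k, ((T k)ᴴ * U)ᴴ * diagonal (Complex.ofReal ∘ (hs k).1.eigenvalues) *
          ((T k)ᴴ * U) = Uᴴ * s k * U := by
        intro k
        conv_rhs => rw [hspec' k]
        simp only [conjTranspose_mul, conjTranspose_conjTranspose, Matrix.mul_assoc]
      have h2 : ∑ k, (w k : ℂ) • (Uᴴ * s k * U) = Uᴴ * σ * U := by
        rw [hsum, Matrix.mul_sum, Matrix.sum_mul]
        simp only [Matrix.mul_smul, Matrix.smul_mul]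
      simp only [h1]
      rw [h2]
      conv_lhs => rw [hspec]
      rw [Matrix.mul_assoc, Matrix.mul_assoc, hUU, Matrix.mul_one, ← Matrix.mul_assoc, hUU,
        Matrix.one_mul])
    (Uᴴ * X * U)
  have h2 : ∀ k, ((T k)ᴴ * U) * (Uᴴ * X * U) * ((T k)ᴴ * U)ᴴ = (T k)ᴴ * X * T k := by
    intro k
    calc ((T k)ᴴ * U) * (Uᴴ * X * U) * ((T k)ᴴ * U)ᴴ
        = (T k)ᴴ * (U * Uᴴ) * X * (U * Uᴴ) * T k := by
          simp only [conjTranspose_mul, conjTranspose_conjTranspose, Matrix.mul_assoc]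
      _ = (T k)ᴴ * X * T k := by rw [hUU', Matrix.mul_one, Matrix.mul_one]
  simp only [h2] at h
  exact h

end ChiSq

/-- The quantum `χ²_f`-divergence is jointly convex in `(ρ,σ)` for any `f ∈ F_op`. -/
theorem chi_sq_f_jointly_convex {n : ℕ} (f : ℝ → ℝ)
    (hfpos : ∀ t : ℝ, 0 < t → 0 < f t) (hmono : OperatorMonotone f)
    (hsym : ∀ t : ℝ, 0 < t → f t = t * f t⁻¹) (hone : f 1 = 1)
    (ρ₁ ρ₂ σ₁ σ₂ : Matrix (Fin n) (Fin n) ℂ)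
    (hρ₁ : ρ₁.PosDef) (hρ₂ : ρ₂.PosDef) (hσ₁ : σ₁.PosDef) (hσ₂ : σ₂.PosDef)
    (hρ₁t : ρ₁.trace = 1) (hρ₂t : ρ₂.trace = 1) (hσ₁t : σ₁.trace = 1) (hσ₂t : σ₂.trace = 1)
    (l : ℝ) (hl0 : 0 ≤ l) (hl1 : l ≤ 1)
    (hσb : (l • σ₁ + (1 - l) • σ₂).PosDef) :
    chiSq f (l • ρ₁ + (1 - l) • ρ₂) (l • σ₁ + (1 - l) • σ₂) hσb.1 ≤
      l * chiSq f ρ₁ σ₁ hσ₁.1 + (1 - l) * chiSq f ρ₂ σ₂ hσ₂.1 := by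
  obtain ⟨X, hX⟩ := exists_chiSq_eq_two_mul_re_trace_sub hfpos (l • ρ₁ + (1 - l) • ρ₂) hσb
  have h1 := mul_le_mul_of_nonneg_left
    (two_mul_re_trace_sub_perspectiveForm_le hfpos ρ₁ hσ₁ X) hl0
  have h2 := mul_le_mul_of_nonneg_left
    (two_mul_re_trace_sub_perspectiveForm_le hfpos ρ₂ hσ₂ X) (sub_nonneg.2 hl1)
  have hconc := hmono.perspectiveForm_concave hsym (w := ![l, 1 - l]) (s := ![σ₁, σ₂])
    (by simp [Fin.forall_fin_two, hl0, hl1]) (by simp [Fin.forall_fin_two, hσ₁, hσ₂]) hσb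
    (by
      simp only [Fin.sum_univ_two, cons_val_zero, cons_val_one]
      rfl) X
  simp only [Fin.sum_univ_two, cons_val_zero, cons_val_one] at hconc
  have htr : (Xᴴ * (l • ρ₁ + (1 - l) • ρ₂ - (l • σ₁ + (1 - l) • σ₂))).trace.re =
      l * (Xᴴ * (ρ₁ - σ₁)).trace.re + (1 - l) * (Xᴴ * (ρ₂ - σ₂)).trace.re := by
    have : l • ρ₁ + (1 - l) • ρ₂ - (l • σ₁ + (1 - l) • σ₂) =
        l • (ρ₁ - σ₁) + (1 - l) • (ρ₂ - σ₂) := by module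
    rw [this, Matrix.mul_add, Matrix.mul_smul, Matrix.mul_smul, trace_add, trace_smul, trace_smul,
      Complex.add_re, Complex.smul_re, Complex.smul_re, smul_eq_mul, smul_eq_mul]
  rw [hX, htr]
  linarith
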